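/- arXiv:2506.14023 — 6 statements merged into one kernel-verified Lean document; each statement's English description precedes it below -/
import Mathlib

section
/- Let ρ : ℝ → ℝ be continuous on [0,∞) with 0 ≤ ρ(w) ≤ 1 for all w ≥ 0, ρ(0) = 1, and ρ(w) → 0 as w → ∞. Let α ∈ (0,1), β ∈ (0,1) and λ > 0. Then there exists u > 0 such that λ/u = (ρ(u) − αβ)(ρ(u) − β). (In the TYC model, β = m_x/c < 1 since the fecundity satisfies c > 1 > m_x, and λ = μm_xm_y/(αcm_z); a solution u of this equation corresponds to a positive equilibrium via u = cx.) -/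
/-- Existence of a positive solution `u` of the scalar equilibrium equation
`λ/u = (ρ(u) − αβ)(ρ(u) − β)`, corresponding to a positive equilibrium of the
discrete TYC model. -/
theorem exists_positive_solution_of_scalar_equation
    (ρ : ℝ → ℝ) (α β lam : ℝ)
    (hρcont : ContinuousOn ρ (Set.Ici 0))
    (hρ01 : ∀ w : ℝ, 0 ≤ w → 0 ≤ ρ w ∧ ρ w ≤ 1)
    (hρ0 : ρ 0 = 1)
    (hρlim : Filter.Tendsto ρ Filter.atTop (nhds 0))
    (hα : 0 < α ∧ α < 1) (hβ : 0 < β ∧ β < 1) (hlam : 0 < lam) :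
    ∃ u : ℝ, 0 < u ∧ lam / u = (ρ u - α * β) * (ρ u - β) := by
  obtain ⟨ha, -⟩ := hα
  obtain ⟨hb, -⟩ := hβ
  have hlim : Filter.Tendsto (fun u => (ρ u - α * β) * (ρ u - β)) Filter.atTop
      (nhds ((0 - α * β) * (0 - β))) :=
    (hρlim.sub_const _).mul (hρlim.sub_const _)
  have hpos : 0 < (0 - α * β) * (0 - β) := by
    have : 0 < α * β * β := by positivity
    linarith
  have htop : Filter.Tendsto (fun u => u * ((ρ u - α * β) * (ρ u - β))) Filter.atTop
      Filter.atTop := Filter.Tendsto.atTop_mul_pos hpos Filter.tendsto_id hlim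
  obtain ⟨U, hU, hU0⟩ :=
    ((htop.eventually_ge_atTop lam).and (Filter.eventually_ge_atTop (0 : ℝ))).exists
  have hc : ContinuousOn (fun u => u * ((ρ u - α * β) * (ρ u - β))) (Set.Icc 0 U) := by
    have h : ContinuousOn ρ (Set.Icc 0 U) := hρcont.mono Set.Icc_subset_Ici_self
    fun_prop
  obtain ⟨u, hu, he⟩ := intermediate_value_Icc hU0 hc
    (show lam ∈ Set.Icc _ _ from ⟨by simpa using hlam.le, hU⟩)
  have he' : u * ((ρ u - α * β) * (ρ u - β)) = lam := he
  have hu0 : 0 < u := by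
    rcases hu.1.eq_or_lt with h | h
    · rw [← h, zero_mul] at he'
      exact absurd he' hlam.ne
    · exact h
  refine ⟨u, hu0, ?_⟩
  rw [div_eq_iff hu0.ne', ← he']
  ring
end

section
/- Consider the discrete-time TYC map F : ℝ³ → ℝ³ defined by F(x,y,z) = ((1−m_x)x + αcρ(cx)·(y/(y+z))·x, (1−m_y)y + (1−α)cρ(cx)·(y/(y+z))·x + cρ(cx)·(z/(y+z))·x, (1−m_z)z + μ) with μ > 0. The extinction equilibrium (0, 0, μ/m_z) is locally asymptotically stable on the nonnegative orthant: for every ε > 0 there exists δ > 0 such that for every initial point (x₀, y₀, z₀) with x₀ ≥ 0, y₀ ≥ 0, z₀ ≥ 0 and ‖(x₀,y₀,z₀) − (0,0,μ/m_z)‖ < δ, the iterates F⁽ⁿ⁾(x₀,y₀,z₀) remain within distance ε of (0,0,μ/m_z) for all n and converge to (0,0,μ/m_z) as n → ∞. -/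
set_option maxHeartbeats 1000000 in
/-- The extinction equilibrium `(0, 0, μ/m_z)` of the discrete-time TYC map is
locally asymptotically stable on the nonnegative orthant. -/
theorem extinction_equilibrium_locally_asymptotically_stable
    (mx my mz α c μ : ℝ) (ρ : ℝ → ℝ)
    (hmx : 0 < mx ∧ mx < 1) (hmy : 0 < my ∧ my < 1) (hmz : 0 < mz ∧ mz < 1)
    (hα : 0 < α ∧ α < 1) (hc : 0 < c) (hμ : 0 < μ)
    (hρ01 : ∀ w : ℝ, 0 ≤ w → 0 ≤ ρ w ∧ ρ w ≤ 1)
    (hρanti : AntitoneOn ρ (Set.Ici 0))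
    (hρ0 : ρ 0 = 1)
    (hρlim : Filter.Tendsto ρ Filter.atTop (nhds 0))
    (F : ℝ × ℝ × ℝ → ℝ × ℝ × ℝ)
    (hF : ∀ x y z : ℝ, F (x, y, z) =
      ((1 - mx) * x + α * c * ρ (c * x) * (y / (y + z)) * x,
       (1 - my) * y + (1 - α) * c * ρ (c * x) * (y / (y + z)) * x
         + c * ρ (c * x) * (z / (y + z)) * x,
       (1 - mz) * z + μ)) :
    ∀ ε : ℝ, 0 < ε → ∃ δ : ℝ, 0 < δ ∧
      ∀ x₀ y₀ z₀ : ℝ, 0 ≤ x₀ → 0 ≤ y₀ → 0 ≤ z₀ →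
        ‖((x₀, y₀, z₀) : ℝ × ℝ × ℝ) - (0, 0, μ / mz)‖ < δ →
        (∀ n : ℕ, ‖F^[n] (x₀, y₀, z₀) - (0, 0, μ / mz)‖ < ε) ∧
        Filter.Tendsto (fun n : ℕ => F^[n] (x₀, y₀, z₀))
          Filter.atTop (nhds (0, 0, μ / mz)) := by
  obtain ⟨hmx0, hmx1⟩ := hmx
  obtain ⟨hmy0, hmy1⟩ := hmy
  obtain ⟨hmz0, hmz1⟩ := hmz
  obtain ⟨hα0, hα1⟩ := hα
  intro ε hε
  obtain ⟨Z, hZ⟩ : ∃ Z, Z = μ / mz := ⟨_, rfl⟩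
  rw [← hZ]
  have hZ0 : 0 < Z := by rw [hZ]; positivity
  have hZμ : μ = mz * Z := by rw [hZ]; field_simp
  obtain ⟨K, hK⟩ : ∃ K, K = 4 * c / mx + 1 := ⟨_, rfl⟩
  have hK1 : 1 ≤ K := by
    have : 0 < 4 * c / mx := by positivity
    linarith
  have hKc : c ≤ K * (mx / 4) := by
    have : K * (mx / 4) = c + mx / 4 := by rw [hK]; field_simp
    linarith
  obtain ⟨D, hD0, hDε, hDZ, hDc⟩ : ∃ D : ℝ, 0 < D ∧ D < ε ∧ D ≤ Z / 2 ∧ c * D ≤ mx * Z / 4 := by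
    refine ⟨min (ε / 2) (min (Z / 2) (mx * Z / 4 / c)), by positivity, ?_, ?_, ?_⟩
    · exact lt_of_le_of_lt (min_le_left _ _) (by linarith)
    · exact (min_le_right _ _).trans (min_le_left _ _)
    · have : min (ε / 2) (min (Z / 2) (mx * Z / 4 / c)) ≤ mx * Z / 4 / c :=
        (min_le_right _ _).trans (min_le_right _ _)
      rw [le_div_iff₀ hc] at this
      linarith
  obtain ⟨q, hq0, hq1, hqx, hqy, hqz⟩ : ∃ q : ℝ, 0 ≤ q ∧ q < 1 ∧ 1 - mx / 4 ≤ q ∧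
      1 - my ≤ q ∧ 1 - mz ≤ q := by
    refine ⟨max (1 - mx / 4) (max (1 - my) (1 - mz)), ?_, ?_, ?_, ?_, ?_⟩
    · exact le_trans (by linarith) (le_max_left _ _)
    · simp only [max_lt_iff]
      refine ⟨?_, ?_, ?_⟩ <;> linarith
    · simp
    · simp
    · simp
  refine ⟨D / (1 + K), by positivity, ?_⟩
  intro x₀ y₀ z₀ hx₀ hy₀ hz₀ hn
  have key : ∀ n : ℕ, ∃ x y z : ℝ, F^[n] (x₀, y₀, z₀) = (x, y, z) ∧ 0 ≤ x ∧ 0 ≤ y ∧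
      y + K * x ≤ q ^ n * D ∧ |z - Z| ≤ q ^ n * D := by
    intro n
    induction n with
    | zero =>
      refine ⟨x₀, y₀, z₀, rfl, hx₀, hy₀, ?_, ?_⟩
      all_goals
        simp only [Prod.mk_sub_mk, Prod.norm_def, Real.norm_eq_abs, max_lt_iff, sub_zero] at hn
        obtain ⟨h1, h2, h3⟩ := hn
        rw [abs_of_nonneg hx₀] at h1
        rw [abs_of_nonneg hy₀] at h2
        have e : D / (1 + K) * (1 + K) = D := by field_simp
        have : 0 < D / (1 + K) := by positivity
        rw [pow_zero, one_mul]
        nlinarith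
    | succ n ih =>
      obtain ⟨x, y, z, he, hx, hy, hV, hz⟩ := ih
      have ht0 : 0 ≤ q ^ n := pow_nonneg hq0 n
      have ht1 : q ^ n ≤ 1 := pow_le_one₀ hq0 hq1.le
      have htD : q ^ n * D ≤ D := mul_le_of_le_one_left hD0.le ht1
      have hKx : 0 ≤ K * x := by positivity
      have hyD : y ≤ D := by linarith
      have hzl : Z / 2 ≤ z := by
        have := (abs_le.mp (hz.trans htD)).1
        linarith
      have hyz : 0 < y + z := by linarith
      obtain ⟨r0, r1⟩ := hρ01 (c * x) (by positivity)
      obtain ⟨A, hA⟩ : ∃ A, A = y / (y + z) := ⟨_, rfl⟩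
      have hB : z / (y + z) = 1 - A := by rw [hA]; field_simp; ring
      have hA0 : 0 ≤ A := by rw [hA]; positivity
      have hA1 : A ≤ 1 := by
        rw [hA, div_le_one hyz]; linarith
      have hcA : c * A ≤ mx / 2 := by
        rw [hA, ← mul_div_assoc, div_le_iff₀ hyz]
        nlinarith
      obtain ⟨r, hr⟩ : ∃ r, r = ρ (c * x) := ⟨_, rfl⟩
      rw [← hr] at r0 r1
      have hstep := hF x y z
      rw [hB, ← hA, ← hr] at hstep
      refine ⟨_, _, _, by rw [Function.iterate_succ_apply', he, hstep], ?_, ?_, ?_, ?_⟩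
      · have : 0 ≤ (1 - mx) * x := mul_nonneg (by linarith) hx
        positivity
      · have h1 : 0 ≤ (1 - my) * y := mul_nonneg (by linarith) hy
        have h2 : 0 ≤ 1 - α := by linarith
        have h3 : 0 ≤ 1 - A := by linarith
        positivity
      · have hX : α * c * r * A * x ≤ mx / 2 * x := by
          apply mul_le_mul_of_nonneg_right _ hx
          have h1 : α * r ≤ 1 := mul_le_one₀ hα1.le r0 r1
          have h2 : 0 ≤ c * A := by positivity
          have h3 : α * r * (c * A) ≤ 1 * (c * A) := mul_le_mul_of_nonneg_right h1 h2
          linarith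
        have hY : (1 - α) * c * r * A * x + c * r * (1 - A) * x ≤ c * x := by
          have h1 : 0 ≤ α * (c * r * A * x) := by positivity
          have h2 : c * x * r ≤ c * x * 1 := mul_le_mul_of_nonneg_left r1 (by positivity)
          linarith
        have h1 : K * ((1 - mx) * x + α * c * r * A * x) ≤ K * ((1 - mx) * x + mx / 2 * x) :=
          mul_le_mul_of_nonneg_left (by linarith) (by linarith)
        have h2 : c * x ≤ K * (mx / 4) * x := mul_le_mul_of_nonneg_right hKc hx
        have h3 : (1 - my) * y ≤ q * y := mul_le_mul_of_nonneg_right hqy hy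
        have h4 : (1 - mx / 4) * (K * x) ≤ q * (K * x) := mul_le_mul_of_nonneg_right hqx hKx
        have h5 : q * (y + K * x) ≤ q * (q ^ n * D) := mul_le_mul_of_nonneg_left hV hq0
        rw [pow_succ]
        linarith
      · have e : (1 - mz) * z + μ - Z = (1 - mz) * (z - Z) := by rw [hZμ]; ring
        rw [e, abs_mul, abs_of_nonneg (by linarith : 0 ≤ 1 - mz), pow_succ]
        calc (1 - mz) * |z - Z| ≤ q * (q ^ n * D) :=
              mul_le_mul hqz hz (abs_nonneg _) hq0
          _ = q ^ n * q * D := by ring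
  have bound : ∀ n : ℕ, ‖F^[n] (x₀, y₀, z₀) - (0, 0, Z)‖ ≤ q ^ n * D := by
    intro n
    obtain ⟨x, y, z, he, hx, hy, hV, hz⟩ := key n
    have hKx : x ≤ K * x := le_mul_of_one_le_left hx hK1
    rw [he]
    simp only [Prod.mk_sub_mk, Prod.norm_def, Real.norm_eq_abs, max_le_iff, sub_zero]
    rw [abs_of_nonneg hx, abs_of_nonneg hy]
    exact ⟨by linarith, by linarith, hz⟩
  constructor
  · intro n
    have ht1 : q ^ n ≤ 1 := pow_le_one₀ hq0 hq1.le
    have := bound n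
    have := mul_le_of_le_one_left hD0.le ht1
    linarith
  · rw [tendsto_iff_norm_sub_tendsto_zero]
    refine squeeze_zero (fun _ => norm_nonneg _) bound ?_
    simpa using (tendsto_pow_atTop_nhds_zero_of_lt_one hq0 hq1).mul_const D
end

section
/- Consider the reduced TYC map without supermales, G : ℝ² → ℝ², G(x,y) = ((1−m_x)x + αcρ(cx)x, (1−m_y)y + (1−α)cρ(cx)x). If m_x > αcρ(0), then the extinction equilibrium (0,0) is globally attracting on the nonnegative quadrant: for every (x₀, y₀) with x₀ ≥ 0 and y₀ ≥ 0, the iterates G⁽ⁿ⁾(x₀, y₀) converge to (0,0) as n → ∞. -/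
/-- For the reduced TYC map without supermales, if `m_x > αcρ(0)` then the
extinction equilibrium `(0,0)` is globally attracting on the nonnegative quadrant. -/
theorem reduced_extinction_globally_attracting
    (mx my α c : ℝ) (ρ : ℝ → ℝ)
    (hmx : 0 < mx ∧ mx < 1) (hmy : 0 < my ∧ my < 1)
    (hα : 0 < α ∧ α < 1) (hc : 0 < c)
    (hρ01 : ∀ w : ℝ, 0 ≤ w → 0 ≤ ρ w ∧ ρ w ≤ 1)
    (hρanti : AntitoneOn ρ (Set.Ici 0))
    (hρ0 : ρ 0 = 1)
    (hρlim : Filter.Tendsto ρ Filter.atTop (nhds 0))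
    (G : ℝ × ℝ → ℝ × ℝ)
    (hG : ∀ x y : ℝ, G (x, y) =
      ((1 - mx) * x + α * c * ρ (c * x) * x,
       (1 - my) * y + (1 - α) * c * ρ (c * x) * x))
    (hcond : α * c * ρ 0 < mx) :
    ∀ x₀ y₀ : ℝ, 0 ≤ x₀ → 0 ≤ y₀ →
      Filter.Tendsto (fun n : ℕ => G^[n] (x₀, y₀))
        Filter.atTop (nhds ((0 : ℝ), (0 : ℝ))) := by
  intro x₀ y₀ hx₀ hy₀
  rw [hρ0] at hcond
  obtain ⟨hα0, hα1⟩ := hα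
  have hαc : 0 < α * c := mul_pos hα0 hc
  obtain ⟨d, hd⟩ : ∃ d, d = mx - α * c := ⟨_, rfl⟩
  have hd0 : 0 < d := by linarith
  have hd1 : d < 1 := by linarith [hmx.2]
  obtain ⟨q, hq⟩ : ∃ q, q = max (1 - d / 2) (1 - my) := ⟨_, rfl⟩
  have hq1 : 1 - d / 2 ≤ q := hq ▸ le_max_left _ _
  have hq2 : 1 - my ≤ q := hq ▸ le_max_right _ _
  have hq0 : 0 ≤ q := by linarith
  have hqlt : q < 1 := by
    rw [hq]
    exact max_lt (by linarith) (by linarith [hmy.1])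
  have step : ∀ x y : ℝ, 0 ≤ x → 0 ≤ y → 0 ≤ (G (x, y)).1 ∧ 0 ≤ (G (x, y)).2 ∧
      2 * c * (G (x, y)).1 + d * (G (x, y)).2 ≤ q * (2 * c * x + d * y) := by
    intro x y hx hy
    obtain ⟨h0, h1⟩ := hρ01 (c * x) (by positivity)
    rw [hG]
    generalize ρ (c * x) = r at h0 h1
    have e1 : 0 ≤ (1 - mx) * x := mul_nonneg (by linarith [hmx.2]) hx
    have e2 : 0 ≤ (1 - my) * y := mul_nonneg (by linarith [hmy.2]) hy
    have e3 : 0 ≤ (1 - α) * c * r * x :=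
      mul_nonneg (mul_nonneg (mul_nonneg (by linarith) hc.le) h0) hx
    have e4 : 0 ≤ α * c * r * x := by positivity
    refine ⟨by simpa using add_nonneg e1 e4, by simpa using add_nonneg e2 e3, ?_⟩
    have f1 : (1 - mx) * x + α * c * r * x ≤ (1 - d) * x := by
      have := mul_nonneg (mul_nonneg hαc.le (sub_nonneg.2 h1)) hx
      rw [hd]
      nlinarith
    have f2 : (1 - α) * c * r * x ≤ c * x := by
      have g1 := mul_nonneg (mul_nonneg hc.le (sub_nonneg.2 h1)) hx
      nlinarith
    have f3 : (1 - d / 2) * (2 * c * x) ≤ q * (2 * c * x) :=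
      mul_le_mul_of_nonneg_right hq1 (by positivity)
    have f4 : (1 - my) * (d * y) ≤ q * (d * y) :=
      mul_le_mul_of_nonneg_right hq2 (by positivity)
    have f5 := mul_le_mul_of_nonneg_left f1 (by positivity : 0 ≤ 2 * c)
    have f6 := mul_le_mul_of_nonneg_left f2 hd0.le
    dsimp only
    nlinarith
  have key : ∀ n : ℕ, 0 ≤ (G^[n] (x₀, y₀)).1 ∧ 0 ≤ (G^[n] (x₀, y₀)).2 ∧
      2 * c * (G^[n] (x₀, y₀)).1 + d * (G^[n] (x₀, y₀)).2 ≤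
        q ^ n * (2 * c * x₀ + d * y₀) := by
    intro n
    induction n with
    | zero => simp [hx₀, hy₀]
    | succ k ih =>
      rw [Function.iterate_succ_apply']
      obtain ⟨h1, h2, h3⟩ := ih
      obtain ⟨s1, s2, s3⟩ := step _ _ h1 h2
      refine ⟨s1, s2, s3.trans ?_⟩
      rw [pow_succ', mul_assoc q]
      exact mul_le_mul_of_nonneg_left h3 hq0
  have lim : ∀ A : ℝ, Filter.Tendsto (fun n : ℕ => q ^ n * (2 * c * x₀ + d * y₀) / A)
      Filter.atTop (nhds 0) := by
    intro A
    simpa using ((tendsto_pow_atTop_nhds_zero_of_lt_one hq0 hqlt).mul_const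
      (2 * c * x₀ + d * y₀)).div_const A
  refine Filter.Tendsto.prodMk_nhds (mx := fun n : ℕ => (G^[n] (x₀, y₀)).1)
    (my := fun n : ℕ => (G^[n] (x₀, y₀)).2) ?_ ?_
  · refine squeeze_zero (fun n => (key n).1) (fun n => ?_) (lim (2 * c))
    rw [le_div_iff₀ (by positivity)]
    have := mul_nonneg hd0.le (key n).2.1
    linarith [(key n).2.2]
  · refine squeeze_zero (fun n => (key n).2.1) (fun n => ?_) (lim d)
    rw [le_div_iff₀ hd0]
    have := mul_nonneg (by positivity : 0 ≤ 2 * c) (key n).1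
    linarith [(key n).2.2]
end

section
/- Consider the reduced TYC map without supermales, G : ℝ² → ℝ², G(x,y) = ((1−m_x)x + αcρ(cx)x, (1−m_y)y + (1−α)cρ(cx)x), and assume ρ is continuous at 0 and m_x < αcρ(0). Then the extinction equilibrium (0,0) is unstable: there exists ε > 0 such that for every δ > 0 there exist an initial point (x₀, y₀) with 0 < x₀ < δ, y₀ = 0, and an integer n ≥ 0 with ‖G⁽ⁿ⁾(x₀, y₀)‖ ≥ ε. -/
/-- For the reduced TYC map without supermales, if `m_x < αcρ(0)` then the
extinction equilibrium `(0,0)` is unstable. -/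
theorem reduced_extinction_unstable
    (mx my α c : ℝ) (ρ : ℝ → ℝ)
    (hmx : 0 < mx ∧ mx < 1) (hmy : 0 < my ∧ my < 1)
    (hα : 0 < α ∧ α < 1) (hc : 0 < c)
    (hρ01 : ∀ w : ℝ, 0 ≤ w → 0 ≤ ρ w ∧ ρ w ≤ 1)
    (hρanti : AntitoneOn ρ (Set.Ici 0))
    (hρ0 : ρ 0 = 1)
    (hρlim : Filter.Tendsto ρ Filter.atTop (nhds 0))
    (hρcont : ContinuousAt ρ 0)
    (G : ℝ × ℝ → ℝ × ℝ)
    (hG : ∀ x y : ℝ, G (x, y) =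
      ((1 - mx) * x + α * c * ρ (c * x) * x,
       (1 - my) * y + (1 - α) * c * ρ (c * x) * x))
    (hcond : mx < α * c * ρ 0) :
    ∃ ε : ℝ, 0 < ε ∧ ∀ δ : ℝ, 0 < δ →
      ∃ x₀ : ℝ, 0 < x₀ ∧ x₀ < δ ∧
        ∃ n : ℕ, ε ≤ ‖G^[n] (x₀, 0)‖ := by
  obtain ⟨k, hk1, hk⟩ : ∃ k : ℝ, 1 < k ∧ k < 1 - mx + α * c * ρ (c * 0) := by
    apply exists_between
    rw [mul_zero]
    linarith
  have hcont : ContinuousAt (fun x : ℝ => 1 - mx + α * c * ρ (c * x)) 0 := by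
    have h1 : ContinuousAt (fun x : ℝ => ρ (c * x)) 0 := by
      apply ContinuousAt.comp (g := ρ) (f := fun x : ℝ => c * x)
      · simpa using hρcont
      · fun_prop
    exact continuousAt_const.add (continuousAt_const.mul h1)
  have hev : ∀ᶠ x in nhds (0 : ℝ), k < 1 - mx + α * c * ρ (c * x) :=
    hcont.eventually_const_lt hk
  obtain ⟨ε, hε, hball⟩ := Metric.eventually_nhds_iff.1 hev
  refine ⟨ε, hε, fun δ hδ => ⟨δ / 2, by linarith, by linarith, ?_⟩⟩
  by_contra! hcon
  have key : ∀ n : ℕ, k ^ n * (δ / 2) ≤ (G^[n] (δ / 2, 0)).1 := by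
    intro n
    induction n with
    | zero => simp
    | succ n ih =>
      rw [Function.iterate_succ_apply']
      have hn := hcon n
      generalize G^[n] (δ / 2, 0) = p at ih hn
      obtain ⟨x, y⟩ := p
      simp only at ih
      have hx : |x| < ε := lt_of_le_of_lt (norm_fst_le (x, y)) hn
      have hg := hball (y := x) (by simpa [Real.dist_eq] using hx)
      have hpos : 0 < k ^ n * (δ / 2) := by positivity
      rw [hG]
      simp only
      calc k ^ (n + 1) * (δ / 2) = k * (k ^ n * (δ / 2)) := by ring
        _ ≤ k * x := by gcongr
        _ ≤ (1 - mx + α * c * ρ (c * x)) * x :=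
          mul_le_mul_of_nonneg_right hg.le (by linarith)
        _ = _ := by ring
  obtain ⟨n, hn⟩ := pow_unbounded_of_one_lt (ε / (δ / 2)) hk1
  rw [div_lt_iff₀ (by linarith)] at hn
  have h1 := (le_abs_self _).trans (norm_fst_le (G^[n] (δ / 2, 0)))
  linarith [key n, hcon n]
end

section
/- Consider the classical continuous-time TYC system with parameters β, δ, K > 0 and μ ≥ 0: f' = (1/2)βLfm − δf, m' = (1/2)βLfm + βLfs − δm, s' = μ − δs, where L = 1 − (f+m+s)/K. There exist strictly positive initial data (f₀, m₀, s₀), times 0 < T₁ < T₂ < ∞, and differentiable functions f, m, s : [0, T₂] → ℝ satisfying the system with f(0) = f₀, m(0) = m₀, s(0) = s₀, such that m(t) < 0 for all t ∈ [T₁, T₂]. -/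
/-- Ill-posedness of the classical continuous-time TYC system: there exist
strictly positive initial data and a time interval `[T₁, T₂]` on which the male
population `m` is negative. -/
theorem classical_TYC_male_population_negative
    (β δ K μ : ℝ) (hβ : 0 < β) (hδ : 0 < δ) (hK : 0 < K) (hμ : 0 ≤ μ) :
    ∃ (f₀ m₀ s₀ : ℝ), 0 < f₀ ∧ 0 < m₀ ∧ 0 < s₀ ∧
    ∃ (T₁ T₂ : ℝ), 0 < T₁ ∧ T₁ < T₂ ∧
    ∃ (f m s : ℝ → ℝ),
      f 0 = f₀ ∧ m 0 = m₀ ∧ s 0 = s₀ ∧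
      (∀ t ∈ Set.Icc (0 : ℝ) T₂,
        HasDerivAt f
          ((1 / 2) * β * (1 - (f t + m t + s t) / K) * f t * m t - δ * f t) t ∧
        HasDerivAt m
          ((1 / 2) * β * (1 - (f t + m t + s t) / K) * f t * m t
            + β * (1 - (f t + m t + s t) / K) * f t * s t - δ * m t) t ∧
        HasDerivAt s (μ - δ * s t) t) ∧
      (∀ t ∈ Set.Icc T₁ T₂, m t < 0) := by
  let v : ℝ × ℝ × ℝ → ℝ × ℝ × ℝ := fun x =>
    ((1 / 2) * β * (1 - (x.1 + x.2.1 + x.2.2) / K) * x.1 * x.2.1 - δ * x.1,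
     (1 / 2) * β * (1 - (x.1 + x.2.1 + x.2.2) / K) * x.1 * x.2.1
            + β * (1 - (x.1 + x.2.1 + x.2.2) / K) * x.1 * x.2.2 - δ * x.2.1,
     μ - δ * x.2.2)
  have hv : ContDiffAt ℝ 1 v (K, 0, K) := by
    apply ContDiff.contDiffAt
    simp only [v, div_eq_mul_inv]
    fun_prop
  obtain ⟨γ, h0, e, he, hγ'⟩ :=
    hv.exists_forall_mem_closedBall_exists_eq_forall_mem_Ioo_hasDerivAt₀ 0
  have hγ : ∀ᶠ t in nhds (0 : ℝ), HasDerivAt γ (v (γ t)) t :=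
    Filter.eventually_of_mem (Ioo_mem_nhds (by linarith) (by linarith)) hγ'
  have hγ0 : HasDerivAt γ (v (γ 0)) 0 := hγ.self_of_nhds
  have hc := hγ0.continuousAt
  have hm0 : HasDerivAt (fun t => (γ t).2.1) (v (γ 0)).2.1 0 := hγ0.snd.fst
  have hneg : (v (γ 0)).2.1 < 0 := by
    have : (v (γ 0)).2.1 = - (β * K * K) := by
      rw [h0]; simp only [v]; field_simp; ring
    rw [this]
    have : 0 < β * K * K := by positivity
    linarith
  have e1 : ∀ᶠ t in nhds (0 : ℝ), 0 < (γ t).1 :=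
    hc.fst.eventually (lt_mem_nhds (by simpa [h0] using hK))
  have e2 : ∀ᶠ t in nhds (0 : ℝ), 0 < (γ t).2.2 :=
    hc.snd.snd.eventually (lt_mem_nhds (by simpa [h0] using hK))
  have e3 := hm0.tendsto_slope.eventually (gt_mem_nhds hneg)
  rw [eventually_nhdsWithin_iff] at e3
  obtain ⟨ε, hε, H⟩ := Metric.eventually_nhds_iff.1 (hγ.and (e1.and (e2.and e3)))
  have H' : ∀ t : ℝ, -ε < t → t < ε → _ := fun t h1 h2 =>
    @H t (by rw [Real.dist_eq, sub_zero]; exact abs_lt.2 ⟨h1, h2⟩)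
  have hs : ∀ t : ℝ, -ε < t → t < ε → t ≠ 0 → t⁻¹ * (γ t).2.1 < 0 := by
    intro t h1 h2 h3
    have := (H' t h1 h2).2.2.2 h3
    simpa [slope_def_field, h0, div_eq_inv_mul] using this
  refine ⟨(γ (-(ε/2))).1, (γ (-(ε/2))).2.1, (γ (-(ε/2))).2.2, ?_, ?_, ?_,
    3 * ε / 4, ε, by linarith, by linarith,
    fun t => (γ (t - ε/2)).1, fun t => (γ (t - ε/2)).2.1, fun t => (γ (t - ε/2)).2.2,
    by simp, by simp, by simp, ?_, ?_⟩
  · exact (H' _ (by linarith) (by linarith)).2.1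
  · have h := hs (-(ε/2)) (by linarith) (by linarith) (by linarith)
    have hi : (-(ε/2))⁻¹ < 0 := inv_lt_zero.2 (by linarith)
    by_contra hh
    have := mul_nonneg_of_nonpos_of_nonpos hi.le (not_lt.1 hh)
    linarith
  · exact (H' _ (by linarith) (by linarith)).2.2.1
  · rintro t ⟨h1, h2⟩
    have h : HasDerivAt (fun t => γ (t - ε/2)) (v (γ (t - ε/2))) t :=
      (H' (t - ε/2) (by linarith) (by linarith)).1.comp_sub_const t (ε/2)
    exact ⟨h.fst, h.snd.fst, h.snd.snd⟩
  · rintro t ⟨h1, h2⟩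
    have h := hs (t - ε/2) (by linarith) (by linarith) (by linarith)
    have hi : 0 < (t - ε/2)⁻¹ := inv_pos.2 (by linarith)
    by_contra hh
    have := mul_nonneg hi.le (not_lt.1 hh)
    linarith
end

section
/- Consider the classical continuous-time TYC system with parameters β, δ, K > 0: f' = (1/2)βLfm − δf, m' = (1/2)βLfm + βLfs − δm, s' = μ − δs, where L = 1 − (f+m+s)/K. For every strictly positive initial datum (f₀, m₀, s₀) there exists a critical value μ* = μ*(f₀, m₀, s₀) > 0 such that for every μ > μ*, there exist a finite time T* ∈ (0, ∞) and differentiable functions f, m, s : [0, T*) → ℝ satisfying the system with f(0) = f₀, m(0) = m₀, s(0) = s₀, for which limsup of f(t) as t → T*⁻ equals +∞ or m(t) → −∞ as t → T*⁻; in particular, for μ > μ* no solution with this initial datum exists on all of [0, ∞). -/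
open Set Filter Topology

/-- Uniqueness of solutions of a C¹ autonomous ODE on an open interval. -/
lemma TYC_unique {E : Type*} [NormedAddCommGroup E] [NormedSpace ℝ E]
    {v : E → E} (hv : ContDiff ℝ 1 v) {a b t₀ : ℝ} (ht₀ : t₀ ∈ Ioo a b) {f g : ℝ → E}
    (hf : ∀ t ∈ Ioo a b, HasDerivAt f (v (f t)) t)
    (hg : ∀ t ∈ Ioo a b, HasDerivAt g (v (g t)) t)
    (h0 : f t₀ = g t₀) : EqOn f g (Ioo a b) := by
  intro t ht
  obtain ⟨a', ha1, ha2⟩ := exists_between (lt_min ht₀.1 ht.1)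
  obtain ⟨b', hb1, hb2⟩ := exists_between (max_lt ht₀.2 ht.2)
  have h1 := lt_min_iff.1 ha2
  have h2 := max_lt_iff.1 hb1
  have hsub : Icc a' b' ⊆ Ioo a b := fun x hx => ⟨ha1.trans_le hx.1, hx.2.trans_lt hb2⟩
  have hfc : ContinuousOn f (Icc a' b') := fun x hx =>
    (hf x (hsub hx)).continuousAt.continuousWithinAt
  have hgc : ContinuousOn g (Icc a' b') := fun x hx =>
    (hg x (hsub hx)).continuousAt.continuousWithinAt
  have hcomp : IsCompact (f '' Icc a' b' ∪ g '' Icc a' b') :=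
    (isCompact_Icc.image_of_continuousOn hfc).union (isCompact_Icc.image_of_continuousOn hgc)
  obtain ⟨C, hC⟩ := LocallyLipschitzOn.exists_lipschitzOnWith_of_compact hcomp
    (hv.locallyLipschitz.locallyLipschitzOn)
  have hs2 : Ioo a' b' ⊆ Icc a' b' := Ioo_subset_Icc_self
  exact ODE_solution_unique_of_mem_Ioo (v := fun _ => v)
    (s := fun _ => f '' Icc a' b' ∪ g '' Icc a' b') (K := C) (fun _ _ => hC) ⟨h1.1, h2.1⟩
    (fun x hx => ⟨hf x (hsub (hs2 hx)), Or.inl ⟨x, hs2 hx, rfl⟩⟩)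
    (fun x hx => ⟨hg x (hsub (hs2 hx)), Or.inr ⟨x, hs2 hx, rfl⟩⟩) h0 ⟨h1.2, h2.2⟩

/-- If there is no global forward solution, there is one which becomes unbounded in
finite time. -/
lemma TYC_maximal {E : Type*} [NormedAddCommGroup E] [NormedSpace ℝ E] [ProperSpace E]
    {v : E → E} (hv : ContDiff ℝ 1 v) (x₀ : E)
    (hno : ¬ ∃ x : ℝ → E, x 0 = x₀ ∧ ∀ t, 0 ≤ t → HasDerivAt x (v (x t)) t) :
    ∃ T : ℝ, 0 < T ∧ ∃ x : ℝ → E, x 0 = x₀ ∧ (∀ t ∈ Ico 0 T, HasDerivAt x (v (x t)) t) ∧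
      ∀ M : ℝ, ¬ ∀ t ∈ Ico 0 T, ‖x t‖ ≤ M := by
  classical
  obtain ⟨α, hα0, ε, hε, hα⟩ :=
    ContDiffAt.exists_forall_mem_closedBall_exists_eq_forall_mem_Ioo_hasDerivAt₀
      (hv.contDiffAt (x := x₀)) 0
  simp only [zero_sub, zero_add] at hα
  set S : Set ℝ := {T | 0 < T ∧ ∃ x : ℝ → E, x 0 = x₀ ∧
    ∀ t ∈ Ioo (-ε) T, HasDerivAt x (v (x t)) t} with hS
  have hεS : ε ∈ S := ⟨hε, α, hα0, hα⟩
  have hex : ∀ T : S, ∃ x : ℝ → E, x 0 = x₀ ∧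
    ∀ t ∈ Ioo (-ε) T.1, HasDerivAt x (v (x t)) t := fun T => T.2.2
  choose X hX0 hX using hex
  let x : ℝ → E := fun t => if h : ∃ T : S, t < T.1 then X h.choose t else 0
  have hxX : ∀ (T : S), ∀ t ∈ Ioo (-ε) T.1, x t = X T t := by
    intro T t ht
    have h : ∃ T : S, t < T.1 := ⟨T, ht.2⟩
    have hx : x t = X h.choose t := dif_pos h
    rw [hx]
    have hl := h.choose_spec
    set T' := h.choose
    exact TYC_unique hv (a := -ε) (b := min T.1 T'.1) (t₀ := 0)
      ⟨by linarith, lt_min T.2.1 T'.2.1⟩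
      (fun s hs => hX T' s ⟨hs.1, hs.2.trans_le (min_le_right _ _)⟩)
      (fun s hs => hX T s ⟨hs.1, hs.2.trans_le (min_le_left _ _)⟩)
      (by rw [hX0, hX0]) ⟨ht.1, lt_min ht.2 hl⟩
  have hxd : ∀ t, -ε < t → (∃ T : S, t < T.1) → HasDerivAt x (v (x t)) t := by
    rintro t ht ⟨T, hT⟩
    have := hX T t ⟨ht, hT⟩
    rw [← hxX T t ⟨ht, hT⟩] at this
    refine this.congr_of_eventuallyEq ?_
    filter_upwards [Ioo_mem_nhds ht hT] with s hs using hxX T s hs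
  have hx0 : x 0 = x₀ := by
    rw [hxX ⟨ε, hεS⟩ 0 ⟨by linarith, hε⟩, hX0]
  have hbdd : BddAbove S := by
    by_contra hb
    refine hno ⟨x, hx0, fun t ht => hxd t (by linarith) ?_⟩
    obtain ⟨T, hT, h⟩ := not_bddAbove_iff.1 hb t
    exact ⟨⟨T, hT⟩, h⟩
  have hne : S.Nonempty := ⟨ε, hεS⟩
  set T := sSup S with hTdef
  have hT : 0 < T := hε.trans_le (le_csSup hbdd hεS)
  have hxT : ∀ t ∈ Ioo (-ε) T, HasDerivAt x (v (x t)) t := by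
    intro t ht
    obtain ⟨T', hT', h⟩ := exists_lt_of_lt_csSup hne ht.2
    exact hxd t ht.1 ⟨⟨T', hT'⟩, h⟩
  refine ⟨T, hT, x, hx0, fun t ht => hxT t ⟨by linarith [ht.1], ht.2⟩, ?_⟩
  intro M hM
  have hcl : ∃ p ∈ Metric.closedBall (0 : E) M, MapClusterPt p (𝓝[<] T) x := by
    refine (isCompact_closedBall (0 : E) M).exists_mapClusterPt ?_
    rw [le_principal_iff, mem_map]
    filter_upwards [Ioo_mem_nhdsLT hT] with t ht
    simpa using hM t ⟨ht.1.le, ht.2⟩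
  obtain ⟨p, -, hp⟩ := hcl
  obtain ⟨r, hr, η, hη, H⟩ :=
    ContDiffAt.exists_forall_mem_closedBall_exists_eq_forall_mem_Ioo_hasDerivAt
      (hv.contDiffAt (x := p)) 0
  have hfr := hp.frequently (Metric.closedBall_mem_nhds p hr)
  have hev : ∀ᶠ t in 𝓝[<] T, t ∈ Ioo (max 0 (T - η)) T :=
    Ioo_mem_nhdsLT (max_lt hT (by linarith))
  obtain ⟨t₁, ht₁p, ht₁⟩ := (hfr.and_eventually hev).exists
  obtain ⟨h1, h2⟩ := max_lt_iff.1 ht₁.1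
  have h3 := ht₁.2
  obtain ⟨γ, hγ0, hγ⟩ := H (x t₁) ht₁p
  simp only [zero_sub, zero_add] at hγ
  let y : ℝ → E := fun t => γ (t - t₁)
  have hy : ∀ t ∈ Ioo (t₁ - η) (t₁ + η), HasDerivAt y (v (y t)) t := by
    intro t ht
    exact (hγ (t - t₁) ⟨by linarith [ht.1], by linarith [ht.2]⟩).comp_sub_const t t₁
  have hxy : EqOn x y (Ioo (max (-ε) (t₁ - η)) T) := by
    refine TYC_unique hv (t₀ := t₁) ⟨max_lt (by linarith) (by linarith), h3⟩ ?_ ?_ ?_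
    · intro t ht
      exact hxT t ⟨(max_lt_iff.1 ht.1).1, ht.2⟩
    · intro t ht
      exact hy t ⟨(max_lt_iff.1 ht.1).2, by linarith [ht.2]⟩
    · simp [y, hγ0]
  let z : ℝ → E := fun t => if t < T then x t else y t
  have hzS : t₁ + η ∈ S := by
    refine ⟨by linarith, z, by simp [z, hT, hx0], ?_⟩
    intro t ht
    rcases lt_or_ge t T with h | h
    · have hz : z t = x t := if_pos h
      rw [hz]
      refine (hxT t ⟨ht.1, h⟩).congr_of_eventuallyEq ?_
      filter_upwards [Iio_mem_nhds h] with s hs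
      exact if_pos hs
    · have hz : z t = y t := if_neg (not_lt.2 h)
      rw [hz]
      refine (hy t ⟨by linarith, ht.2⟩).congr_of_eventuallyEq ?_
      have : max (-ε) (t₁ - η) < t := max_lt (by linarith) (by linarith)
      filter_upwards [Ioi_mem_nhds this] with s hs
      by_cases hsT : s < T
      · simp only [z, if_pos hsT]
        exact hxy ⟨hs, hsT⟩
      · simp only [z, if_neg hsT]
  have := le_csSup hbdd hzS
  linarith

/-- Fencing lemma: a function can't cross zero downwards. -/
lemma TYC_fence {g g' : ℝ → ℝ} {a b : ℝ} (hab : a ≤ b)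
    (hg : ∀ t ∈ Icc a b, HasDerivAt g (g' t) t) (ha : 0 ≤ g a)
    (h : ∀ t ∈ Icc a b, g t = 0 → 0 < g' t) : 0 ≤ g b := by
  refine image_le_of_deriv_right_lt_deriv_boundary' (f := fun _ => (0:ℝ)) (f' := fun _ => 0)
    (B := g) (B' := g') (a := a) (b := b) continuousOn_const
    (fun x _ => hasDerivWithinAt_const _ _ _) ha
    (fun x hx => (hg x hx).continuousAt.continuousWithinAt)
    (fun x hx => (hg x ⟨hx.1, hx.2.le⟩).hasDerivWithinAt)
    (fun x hx h0 => h x ⟨hx.1, hx.2.le⟩ h0.symm) ⟨hab, le_rfl⟩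

lemma TYC_sq_pos_part (x : ℝ) : HasDerivAt (fun y : ℝ => (max y 0) ^ 2) (2 * max x 0) x := by
  rcases lt_trichotomy x 0 with h | h | h
  · rw [max_eq_right h.le, mul_zero]
    refine (hasDerivAt_const x (0:ℝ)).congr_of_eventuallyEq ?_
    filter_upwards [Iio_mem_nhds h] with y hy
    simp [max_eq_right (le_of_lt (show y < 0 from hy))]
  · subst h
    rw [max_self, mul_zero, hasDerivAt_iff_isLittleO]
    simp only [sub_zero, max_self, smul_zero, ne_eq, OfNat.ofNat_ne_zero, not_false_eq_true,
      zero_pow]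
    refine Asymptotics.IsBigO.trans_isLittleO (g := fun y : ℝ => y ^ 2) ?_ ?_
    · refine Asymptotics.IsBigO.of_bound 1 (Eventually.of_forall fun y => ?_)
      simp only [norm_pow, Real.norm_eq_abs, one_mul]
      refine pow_le_pow_left₀ (abs_nonneg _) ?_ 2
      rcases le_total y 0 with h | h <;> simp [h]
    · exact Asymptotics.isLittleO_pow_id one_lt_two
  · rw [max_eq_left h.le]
    have := hasDerivAt_pow 2 x
    simp only [Nat.cast_ofNat, Nat.add_one_sub_one, pow_one] at this
    refine this.congr_of_eventuallyEq ?_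
    filter_upwards [Ioi_mem_nhds h] with y hy
    rw [max_eq_left (le_of_lt (show 0 < y from hy))]

/-- Solutions of the TYC system on `[0, b]`, with `k = β / (2 K)`. -/
structure TYCSol (k δ K μ : ℝ) (f m s : ℝ → ℝ) (b : ℝ) : Prop where
  df : ∀ t ∈ Icc 0 b, HasDerivAt f (-(k * (f t + m t + s t - K) * f t * m t) - δ * f t) t
  dm : ∀ t ∈ Icc 0 b, HasDerivAt m
    (-(k * (f t + m t + s t - K) * f t * (m t + 2 * s t)) - δ * m t) t
  ds : ∀ t ∈ Icc 0 b, HasDerivAt s (μ - δ * s t) t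

lemma TYCSol.mono {k δ K μ : ℝ} {f m s : ℝ → ℝ} {b b' : ℝ} (h : TYCSol k δ K μ f m s b)
    (hb : b' ≤ b) : TYCSol k δ K μ f m s b' :=
  ⟨fun t ht => h.df t ⟨ht.1, ht.2.trans hb⟩, fun t ht => h.dm t ⟨ht.1, ht.2.trans hb⟩,
    fun t ht => h.ds t ⟨ht.1, ht.2.trans hb⟩⟩

lemma TYCSol.f_pos {k δ K μ : ℝ} {f m s : ℝ → ℝ} {b : ℝ} (h : TYCSol k δ K μ f m s b)
    (hb : 0 ≤ b) (hf0 : 0 < f 0) : 0 < f b := by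
  have cf : ContinuousOn f (Icc 0 b) := fun t ht => (h.df t ht).continuousAt.continuousWithinAt
  have cm : ContinuousOn m (Icc 0 b) := fun t ht => (h.dm t ht).continuousAt.continuousWithinAt
  have cs : ContinuousOn s (Icc 0 b) := fun t ht => (h.ds t ht).continuousAt.continuousWithinAt
  have cg : ContinuousOn (fun t => k * (f t + m t + s t - K) * m t + δ) (Icc 0 b) := by
    fun_prop
  obtain ⟨C, hC⟩ := isCompact_Icc.exists_bound_of_continuousOn cg
  have key := TYC_fence (g := fun t => f t - f 0 * Real.exp (-(C + 1) * t))
    (g' := fun t => -(k * (f t + m t + s t - K) * f t * m t) - δ * f t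
      - f 0 * (Real.exp (-(C + 1) * t) * (-(C + 1)))) hb ?_ ?_ ?_
  · have := mul_pos hf0 (Real.exp_pos (-(C + 1) * b))
    linarith
  · intro t ht
    have h1 : HasDerivAt (fun t : ℝ => -(C + 1) * t) (-(C + 1)) t := by
      simpa using (hasDerivAt_id t).const_mul (-(C + 1))
    exact (h.df t ht).sub (h1.exp.const_mul (f 0))
  · simp
  · intro t ht h0
    have hfe : f 0 * Real.exp (-(C + 1) * t) = f t := by linarith
    have hfp : 0 < f t := by rw [← hfe]; positivity
    have hc := hC t ht
    rw [Real.norm_eq_abs] at hc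
    have hc' := (abs_le.1 hc).2
    have e : -(k * (f t + m t + s t - K) * f t * m t) - δ * f t
      - f 0 * (Real.exp (-(C + 1) * t) * (-(C + 1))) =
      f t * (C + 1 - (k * (f t + m t + s t - K) * m t + δ)) := by
      linear_combination (C + 1) * hfe
    rw [e]
    apply mul_pos hfp
    linarith

lemma TYCSol.s_eq {k δ K μ : ℝ} {f m s : ℝ → ℝ} {b : ℝ} (h : TYCSol k δ K μ f m s b)
    (hb : 0 ≤ b) (hδ : 0 < δ) :
    s b = s 0 + (μ / δ - s 0) * (1 - Real.exp (-δ * b)) := by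
  have hd : ∀ t ∈ Icc 0 b, HasDerivAt (fun t => (s t - μ / δ) * Real.exp (δ * t)) 0 t := by
    intro t ht
    have h1 : HasDerivAt (fun t : ℝ => δ * t) δ t := by
      simpa using (hasDerivAt_id t).const_mul δ
    refine (((h.ds t ht).sub_const (μ / δ)).mul h1.exp).congr_deriv ?_
    field_simp
    ring
  have := constant_of_has_deriv_right_zero
    (fun t ht => (hd t ht).continuousAt.continuousWithinAt)
    (fun t ht => (hd t ⟨ht.1, ht.2.le⟩).hasDerivWithinAt) b ⟨hb, le_rfl⟩
  simp only [mul_zero, Real.exp_zero, mul_one] at this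
  have e : Real.exp (-δ * b) * Real.exp (δ * b) = 1 := by
    rw [← Real.exp_add]; simp
  have : s b - μ / δ = (s 0 - μ / δ) * Real.exp (-δ * b) := by
    rw [← this]; linear_combination (-(s b - μ / δ)) * e
  linear_combination this

lemma TYCSol.s_bounds {k δ K μ : ℝ} {f m s : ℝ → ℝ} {b : ℝ} (h : TYCSol k δ K μ f m s b)
    (hb : 0 ≤ b) (hδ : 0 < δ) (hμ : δ * s 0 < μ) :
    s 0 ≤ s b ∧ s b ≤ μ / δ ∧ s b ≤ s 0 + (μ - δ * s 0) * b := by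
  have e := h.s_eq hb hδ
  have h1 : 0 < μ / δ - s 0 := by
    rw [sub_pos, lt_div_iff₀ hδ]; linarith
  have h2 : Real.exp (-δ * b) ≤ 1 := by
    rw [Real.exp_le_one_iff]; nlinarith
  have h3 := Real.exp_pos (-δ * b)
  have h4 := Real.add_one_le_exp (-δ * b)
  refine ⟨by nlinarith, by nlinarith, ?_⟩
  have : (μ - δ * s 0) * b = (μ / δ - s 0) * (δ * b) := by field_simp
  rw [this, e]
  have := mul_le_mul_of_nonneg_left (show 1 - Real.exp (-δ * b) ≤ δ * b by linarith) h1.le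
  linarith

lemma TYCSol.dp {k δ K μ : ℝ} {f m s : ℝ → ℝ} {b : ℝ} (h : TYCSol k δ K μ f m s b) :
    ∀ t ∈ Icc 0 b, HasDerivAt (fun t => f t + m t + s t - K)
      (μ - δ * (f t + m t + s t) - 2 * k * (f t + m t + s t - K) * (f t * (m t + s t))) t := by
  intro t ht
  refine ((((h.df t ht).add (h.dm t ht)).add (h.ds t ht)).sub_const K).congr_deriv ?_
  ring

/-- Elementary a priori bounds. -/
lemma TYCSol.basic {k δ K μ : ℝ} {f m s : ℝ → ℝ} {b : ℝ} (h : TYCSol k δ K μ f m s b)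
    (hb : 0 ≤ b) (hk : 0 < k) (hδ : 0 < δ) (hK : 0 < K) (hμ : δ * s 0 < μ) (hμK : δ * K < μ)
    (hf0 : 0 < f 0) (hm0 : 0 < m 0) (hs0 : 0 < s 0) :
    m b ≤ K + f 0 + m 0 ∧ -(2 * s b) ≤ m b ∧ (f b + m b + s b - K < 0 → 0 ≤ m b) := by
  have fp : ∀ t ∈ Icc 0 b, 0 < f t := fun t ht => (h.mono ht.2).f_pos ht.1 hf0
  have sp : ∀ t ∈ Icc 0 b, 0 < s t := fun t ht =>
    hs0.trans_le ((h.mono ht.2).s_bounds ht.1 hδ hμ).1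
  have hμ0 : 0 < μ := lt_trans (by positivity) hμ
  refine ⟨?_, ?_, ?_⟩
  · have := TYC_fence (g := fun t => (K + f 0 + m 0) - m t) hb
      (fun t ht => (h.dm t ht).const_sub _) (by linarith) ?_
    · linarith
    · intro t ht h0
      have hm : 0 < m t := by linarith
      have hp : 0 < f t + m t + s t - K := by linarith [fp t ht, sp t ht]
      have := fp t ht
      have := sp t ht
      have : 0 < k * (f t + m t + s t - K) * f t * (m t + 2 * s t) := by positivity
      have : 0 < δ * m t := by positivity
      linarith
  · have := TYC_fence (g := fun t => m t + 2 * s t) hb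
      (fun t ht => (h.dm t ht).add ((h.ds t ht).const_mul 2)) (by linarith) ?_
    · linarith
    · intro t ht h0
      rw [h0]
      have : m t = -2 * s t := by linarith
      rw [this]
      linarith
  · intro hp
    have hpt : ∀ t ∈ Icc 0 b, f t + m t + s t - K < 0 := by
      intro t ht
      by_contra hcon
      push Not at hcon
      have := TYC_fence (g := fun t => f t + m t + s t - K) ht.2
        (fun r hr => h.dp r ⟨ht.1.trans hr.1, hr.2⟩) hcon ?_
      · linarith
      · intro r hr h0
        have e : f r + m r + s r = K := by linarith
        rw [h0, e]
        linarith
    refine TYC_fence (g := m) hb h.dm hm0.le ?_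
    intro t ht h0
    have h1 := hpt t ht
    rw [h0] at h1 ⊢
    have := fp t ht
    have := sp t ht
    have : 0 < k * (-(f t + 0 + s t - K)) * f t * (2 * s t) :=
      mul_pos (mul_pos (mul_pos hk (by linarith)) (by assumption)) (by linarith)
    linarith

/-- The excess `f + m + s - K` becomes larger than `c` by time `1`. -/
lemma TYCSol.excess {k δ K μ c : ℝ} {f m s : ℝ → ℝ} {b : ℝ} (h : TYCSol k δ K μ f m s b)
    (hb : 1 ≤ b) (hk : 0 < k) (hδ : 0 < δ) (hK : 0 < K) (hc : 0 < c)
    (hμ : δ * s 0 < μ)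
    (hμc : δ * (c + K) + k * c * (K + c) ^ 2 + (c + K) < μ)
    (hf0 : 0 < f 0) (hm0 : 0 < m 0) (hs0 : 0 < s 0) :
    c ≤ f b + m b + s b - K := by
  have hμK : δ * K < μ := by
    have : 0 < k * c * (K + c) ^ 2 := by positivity
    nlinarith [mul_pos hδ hc]
  have grow : ∀ t ∈ Icc 0 b, f t + m t + s t - K ≤ c → c + K <
      μ - δ * (f t + m t + s t) - 2 * k * (f t + m t + s t - K) * (f t * (m t + s t)) := by
    intro t ht hpc
    have fp := (h.mono ht.2).f_pos ht.1 hf0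
    have sp := ((h.mono ht.2).s_bounds ht.1 hδ hμ).1
    obtain ⟨-, -, hm⟩ := (h.mono ht.2).basic ht.1 hk hδ hK hμ hμK hf0 hm0 hs0
    have h1 : δ * (f t + m t + s t) ≤ δ * (c + K) :=
      mul_le_mul_of_nonneg_left (by linarith) hδ.le
    have h2 : 0 < k * c * (K + c) ^ 2 := by positivity
    suffices 2 * k * (f t + m t + s t - K) * (f t * (m t + s t)) ≤ k * c * (K + c) ^ 2 by
      linarith
    rcases lt_or_ge (f t + m t + s t - K) 0 with hp | hp
    · have hm := hm hp
      have : 0 ≤ f t * (m t + s t) := mul_nonneg fp.le (by linarith)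
      have : 0 ≤ k * (-(f t + m t + s t - K)) * (f t * (m t + s t)) :=
        mul_nonneg (mul_nonneg hk.le (by linarith)) this
      linarith
    · have h3 : f t * (m t + s t) ≤ (K + c) ^ 2 / 4 := by
        have h4 : (f t + (m t + s t)) ^ 2 ≤ (K + c) ^ 2 :=
          pow_le_pow_left₀ (by linarith) (by linarith) 2
        nlinarith [sq_nonneg (f t - (m t + s t))]
      have h5 : (f t + m t + s t - K) * (f t * (m t + s t)) ≤
          (f t + m t + s t - K) * ((K + c) ^ 2 / 4) := mul_le_mul_of_nonneg_left h3 hp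
      have h6 : (f t + m t + s t - K) * ((K + c) ^ 2 / 4) ≤ c * ((K + c) ^ 2 / 4) :=
        mul_le_mul_of_nonneg_right hpc (by positivity)
      have h7 := mul_le_mul_of_nonneg_left (h5.trans h6) (show 0 ≤ 2 * k by linarith)
      nlinarith
  have hone : 0 ≤ (f 1 + m 1 + s 1 - K) - ((c + K) * 1 - K) := by
    refine TYC_fence (g := fun t => (f t + m t + s t - K) - ((c + K) * t - K))
      (g' := fun t => μ - δ * (f t + m t + s t) - 2 * k * (f t + m t + s t - K) *
        (f t * (m t + s t)) - (c + K)) zero_le_one ?_ ?_ ?_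
    · intro t ht
      have h1 : HasDerivAt (fun t : ℝ => (c + K) * t - K) (c + K) t := by
        simpa using ((hasDerivAt_id t).const_mul (c + K)).sub_const K
      exact (h.dp t ⟨ht.1, ht.2.trans hb⟩).sub h1
    · linarith
    · intro t ht h0
      have : (c + K) * t ≤ c + K := by nlinarith [ht.2]
      have := grow t ⟨ht.1, ht.2.trans hb⟩ (by linarith)
      linarith
  have := TYC_fence (g := fun t => (f t + m t + s t - K) - c) hb
    (fun t ht => (h.dp t ⟨by linarith [ht.1], ht.2⟩).sub_const c) (by linarith) ?_
  · linarith
  · intro t ht h0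
    have := grow t ⟨by linarith [ht.1], ht.2⟩ (by linarith)
    linarith

set_option maxHeartbeats 1000000 in
/-- Lower bound of `f` on `[1, 2]`. -/
lemma TYCSol.f_lower {k δ K μ A B C : ℝ} {f m s : ℝ → ℝ} {b : ℝ} (h : TYCSol k δ K μ f m s b)
    (hb : 1 ≤ b) (hb2 : b ≤ 2) (hk : 0 < k) (hδ : 0 < δ) (hK : 0 < K)
    (hμ : δ * s 0 < μ) (hμK : δ * K < μ)
    (hf0 : 0 < f 0) (hm0 : 0 < m 0) (hs0 : 0 < s 0)
    (hB : B = K + f 0 + m 0) (hA : A = 2 * B ^ 2 / f 0)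
    (hC : C = k * (f 0 + B + s 0 + A) * f 0 * B + δ * f 0 + 1)
    (hμA : 2 * δ * (s 0 + A) < μ) (hμA1 : A ≤ μ) (hμC : 2 * C * A / f 0 ≤ μ)
    (hμ3 : 2 * k * K ^ 3 ≤ μ) :
    f 0 / 4 * Real.exp (-4 * δ) ≤ f b := by
  have hB0 : 0 < B := by rw [hB]; positivity
  have hA0 : 0 < A := by rw [hA]; positivity
  have hC0 : 0 < C := by rw [hC]; positivity
  have hμ0 : 0 < μ := lt_of_lt_of_le hA0 hμA1
  have fp : ∀ t ∈ Icc 0 b, 0 < f t := fun t ht => (h.mono ht.2).f_pos ht.1 hf0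
  have sb := fun t (ht : t ∈ Icc 0 b) => (h.mono ht.2).s_bounds ht.1 hδ hμ
  have mb := fun t (ht : t ∈ Icc 0 b) =>
    (h.mono ht.2).basic ht.1 hk hδ hK hμ hμK hf0 hm0 hs0
  rw [← hB] at mb
  set τ := A / μ with hτ
  have hτ0 : 0 < τ := by positivity
  have hτ1 : τ ≤ 1 := by rw [hτ, div_le_one hμ0]; exact hμA1
  have hμτ : μ * τ = A := by rw [hτ]; field_simp
  have hCτ : C * τ ≤ f 0 / 2 := by
    rw [div_le_iff₀ hf0] at hμC
    rw [hτ, ← mul_div_assoc, div_le_iff₀ hμ0]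
    linarith
  have sA : ∀ t ∈ Icc 0 τ, s t ≤ s 0 + A := by
    intro t ht
    have h1 := (sb t ⟨ht.1, by linarith [ht.2]⟩).2.2
    have h2 : (μ - δ * s 0) * t ≤ μ * τ :=
      mul_le_mul (by nlinarith) ht.2 ht.1 hμ0.le
    linarith
  -- the value of s at time τ
  have sτ : A / 2 ≤ s τ := by
    have h1 : 0 ≤ s τ - (s 0 + μ / 2 * τ) := by
      refine TYC_fence (g := fun t => s t - (s 0 + μ / 2 * t))
        (g' := fun t => μ - δ * s t - μ / 2) hτ0.le ?_ ?_ ?_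
      · intro t ht
        have h1 : HasDerivAt (fun t : ℝ => s 0 + μ / 2 * t) (μ / 2) t := by
          simpa using ((hasDerivAt_id t).const_mul (μ / 2)).const_add (s 0)
        exact (h.ds t ⟨ht.1, by linarith [ht.2]⟩).sub h1
      · simp
      · intro t ht _
        have := mul_le_mul_of_nonneg_left (sA t ht) hδ.le
        linarith
    linarith
  -- sign property
  have sgn : ∀ t ∈ Icc 0 b, m t < 0 ∨ f t + m t + s t - K < 0 →
      0 ≤ -(k * (f t + m t + s t - K) * f t * m t) := by
    intro t ht hor
    have h1 := (mb t ht).2.2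
    have h2 : (f t + m t + s t - K) * m t ≤ 0 := by
      rcases hor with hm | hp
      · have : 0 ≤ f t + m t + s t - K := by
          by_contra hcon
          push Not at hcon
          linarith [h1 hcon]
        exact mul_nonpos_of_nonneg_of_nonpos this hm.le
      · exact mul_nonpos_of_nonpos_of_nonneg hp.le (h1 hp)
    have := mul_nonneg (mul_nonneg hk.le (fp t ht).le) (neg_nonneg.2 h2)
    linarith
  -- the value of f at time τ
  have fτ : f 0 / 2 ≤ f τ := by
    have h1 : 0 ≤ f τ - (f 0 - C * τ) := by
      refine TYC_fence (g := fun t => f t - (f 0 - C * t))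
        (g' := fun t => -(k * (f t + m t + s t - K) * f t * m t) - δ * f t - (-C))
        hτ0.le ?_ ?_ ?_
      · intro t ht
        have h1 : HasDerivAt (fun t : ℝ => f 0 - C * t) (-C) t := by
          simpa using ((hasDerivAt_id t).const_mul C).const_sub (f 0)
        exact (h.df t ⟨ht.1, by linarith [ht.2]⟩).sub h1
      · simp
      · intro t ht h0
        have htb : t ∈ Icc 0 b := ⟨ht.1, by linarith [ht.2]⟩
        have hft : f t ≤ f 0 := by nlinarith [ht.1]
        have hfp := fp t htb
        have h2 : δ * f t ≤ δ * f 0 := mul_le_mul_of_nonneg_left hft hδ.le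
        have h3 : 0 < k * (f 0 + B + s 0 + A) * f 0 * B := by positivity
        by_cases hor : m t < 0 ∨ f t + m t + s t - K < 0
        · have := sgn t htb hor
          linarith
        · push Not at hor
          have h4 : k * (f t + m t + s t - K) ≤ k * (f 0 + B + s 0 + A) :=
            mul_le_mul_of_nonneg_left (by linarith [(mb t htb).1, sA t ht]) hk.le
          have h5 : k * (f t + m t + s t - K) * f t ≤ k * (f 0 + B + s 0 + A) * f 0 :=
            mul_le_mul h4 hft hfp.le (by positivity)
          have h6 : k * (f t + m t + s t - K) * f t * m t ≤
              k * (f 0 + B + s 0 + A) * f 0 * B :=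
            mul_le_mul h5 (mb t htb).1 hor.1 (by positivity)
          linarith
    linarith
  -- Lyapunov function
  have key : 0 ≤ (f b - (max (m b) 0) ^ 2 / (4 * s b)) - f 0 / 4 * Real.exp (-2 * δ * b) := by
    refine TYC_fence
      (g := fun t => (f t - (max (m t) 0) ^ 2 / (4 * s t)) - f 0 / 4 * Real.exp (-2 * δ * t))
      (g' := fun t => (-(k * (f t + m t + s t - K) * f t * m t) - δ * f t -
        (2 * max (m t) 0 * (-(k * (f t + m t + s t - K) * f t * (m t + 2 * s t)) - δ * m t)
          * (4 * s t) - (max (m t) 0) ^ 2 * (4 * (μ - δ * s t))) / (4 * s t) ^ 2)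
        - f 0 / 4 * (Real.exp (-2 * δ * t) * (-2 * δ))) (hτ1.trans hb) ?_ ?_ ?_
    · intro t ht
      have htb : t ∈ Icc 0 b := ⟨by linarith [ht.1], ht.2⟩
      have h1 : HasDerivAt (fun t : ℝ => -2 * δ * t) (-2 * δ) t := by
        simpa using (hasDerivAt_id t).const_mul (-2 * δ)
      have sp : 0 < s t := hs0.trans_le (sb t htb).1
      have h2 : HasDerivAt (fun t => (max (m t) 0) ^ 2) (2 * max (m t) 0 *
          (-(k * (f t + m t + s t - K) * f t * (m t + 2 * s t)) - δ * m t)) t :=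
        (TYC_sq_pos_part (m t)).comp t (h.dm t htb)
      exact ((h.df t htb).sub (h2.div ((h.ds t htb).const_mul 4) (by positivity))).sub
        (h1.exp.const_mul (f 0 / 4))
    · have h1 : Real.exp (-2 * δ * τ) ≤ 1 := by
        rw [Real.exp_le_one_iff]; nlinarith
      have hτb : τ ∈ Icc 0 b := ⟨hτ0.le, by linarith⟩
      have h2 : (max (m τ) 0) ^ 2 ≤ B ^ 2 :=
        pow_le_pow_left₀ (le_max_right _ _) (max_le (mb τ hτb).1 hB0.le) 2
      have h3 : (max (m τ) 0) ^ 2 / (4 * s τ) ≤ f 0 / 4 := by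
        have sp : 0 < s τ := hs0.trans_le (sb τ hτb).1
        rw [div_le_iff₀ (by positivity)]
        have h4 : A * f 0 = 2 * B ^ 2 := by rw [hA]; field_simp
        have h5 := mul_le_mul_of_nonneg_left sτ hf0.le
        nlinarith
      nlinarith
    · intro t ht h0
      have htb : t ∈ Icc 0 b := ⟨by linarith [ht.1], ht.2⟩
      have hfp := fp t htb
      have sp : 0 < s t := hs0.trans_le (sb t htb).1
      have hE : 0 < f 0 / 4 * Real.exp (-2 * δ * t) := by positivity
      set E := f 0 / 4 * Real.exp (-2 * δ * t) with hEdef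
      have e1 : f 0 / 4 * (Real.exp (-2 * δ * t) * (-2 * δ)) = -2 * δ * E := by
        rw [hEdef]; ring
      rw [e1]
      rcases le_or_gt (m t) 0 with hm | hm
      · rw [max_eq_right hm] at h0 ⊢
        have h1 : f t = E := by
          have : (0:ℝ) ^ 2 / (4 * s t) = 0 := by simp
          linarith
        have h2 : 0 ≤ -(k * (f t + m t + s t - K) * f t * m t) := by
          rcases hm.lt_or_eq with hm | hm
          · exact sgn t htb (Or.inl hm)
          · rw [hm]; simp
        have h3 : (2 * 0 * (-(k * (f t + m t + s t - K) * f t * (m t + 2 * s t)) - δ * m t)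
          * (4 * s t) - 0 ^ 2 * (4 * (μ - δ * s t))) / (4 * s t) ^ 2 = 0 := by simp
        rw [h3, h1] at *
        linarith [mul_pos hδ hE]
      · rw [max_eq_left hm.le] at h0 ⊢
        have hf : f t = E + (m t) ^ 2 / (4 * s t) := by linarith
        have hdiff : -(k * (f t + m t + s t - K) * f t * m t) - δ * f t -
          (2 * m t * (-(k * (f t + m t + s t - K) * f t * (m t + 2 * s t)) - δ * m t)
          * (4 * s t) - (m t) ^ 2 * (4 * (μ - δ * s t))) / (4 * s t) ^ 2 =
          -δ * (f t - (m t) ^ 2 / (4 * s t)) + (m t) ^ 2 / (4 * (s t) ^ 2) *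
          (2 * k * (f t + m t + s t - K) * f t * s t + μ) := by
          field_simp
          ring
        rw [hdiff]
        have h1 : f t - (m t) ^ 2 / (4 * s t) = E := by linarith
        rw [h1]
        have h2 : 0 ≤ 2 * k * (f t + m t + s t - K) * f t * s t + μ := by
          rcases lt_or_ge (f t + m t + s t - K) 0 with hp | hp
          · have h3 : (-(f t + m t + s t - K)) * f t * s t ≤ K * K * K := by
              refine mul_le_mul (mul_le_mul ?_ ?_ hfp.le hK.le) ?_ sp.le (by positivity) <;>
              linarith
            have h4 := mul_le_mul_of_nonneg_left h3 (show 0 ≤ 2 * k by linarith)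
            linarith
          · positivity
        have h3 : 0 ≤ (m t) ^ 2 / (4 * (s t) ^ 2) *
          (2 * k * (f t + m t + s t - K) * f t * s t + μ) := mul_nonneg (by positivity) h2
        linarith [mul_pos hδ hE]
  have sp : 0 < s b := hs0.trans_le (sb b ⟨by linarith, le_rfl⟩).1
  have h1 : 0 ≤ (max (m b) 0) ^ 2 / (4 * s b) := by positivity
  have h2 : Real.exp (-4 * δ) ≤ Real.exp (-2 * δ * b) := by
    rw [Real.exp_le_exp]; nlinarith
  have h3 := mul_le_mul_of_nonneg_left h2 (show 0 ≤ f 0 / 4 by positivity)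
  linarith

set_option maxHeartbeats 1000000 in
/-- No global solution for large `μ`. -/
lemma TYC_no_global {k δ K μ A B C c κ fl : ℝ} {f m s : ℝ → ℝ}
    (h : ∀ b, TYCSol k δ K μ f m s b)
    (hk : 0 < k) (hδ : 0 < δ) (hK : 0 < K)
    (hμ : δ * s 0 < μ)
    (hf0 : 0 < f 0) (hm0 : 0 < m 0) (hs0 : 0 < s 0)
    (hB : B = K + f 0 + m 0) (hA : A = 2 * B ^ 2 / f 0)
    (hC : C = k * (f 0 + B + s 0 + A) * f 0 * B + δ * f 0 + 1)
    (hκ : κ = (1 - Real.exp (-δ)) / δ) (hfl : fl = f 0 / 4 * Real.exp (-4 * δ))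
    (hc : c = (10 + 8 / δ) / (2 * k * fl * κ))
    (hμc : δ * (c + K) + k * c * (K + c) ^ 2 + (c + K) < μ)
    (hμA : 2 * δ * (s 0 + A) < μ) (hμA1 : A ≤ μ) (hμC : 2 * C * A / f 0 ≤ μ)
    (hμ3 : 2 * k * K ^ 3 ≤ μ) (hμB : B < μ) (hμ1 : 1 ≤ μ) (hμk : δ ^ 2 / (k * κ) ≤ μ) :
    False := by
  have hμ0 : 0 < μ := by linarith
  have hκ0 : 0 < κ := by
    rw [hκ]
    refine div_pos ?_ hδ
    rw [sub_pos, Real.exp_lt_one_iff]; linarith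
  have hfl0 : 0 < fl := by rw [hfl]; positivity
  have hc0 : 0 < c := by rw [hc]; positivity
  have hμK : δ * K < μ := by
    have : 0 < k * c * (K + c) ^ 2 := by positivity
    nlinarith [mul_pos hδ hc0]
  have fp : ∀ t, 0 ≤ t → 0 < f t := fun t ht => (h t).f_pos ht hf0
  have sb := fun t (ht : 0 ≤ t) => (h t).s_bounds ht hδ hμ
  have mb := fun t (ht : 0 ≤ t) => (h t).basic ht hk hδ hK hμ hμK hf0 hm0 hs0
  rw [← hB] at mb
  have sκ : ∀ t, 1 ≤ t → κ * μ ≤ s t := by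
    intro t ht
    rw [(h t).s_eq (by linarith) hδ]
    have h1 : Real.exp (-δ * t) ≤ Real.exp (-δ) := by
      rw [Real.exp_le_exp]; nlinarith
    have h2 := Real.exp_pos (-δ * t)
    have h3 : κ * μ = μ / δ * (1 - Real.exp (-δ)) := by rw [hκ]; field_simp
    have h4 : 0 < μ / δ := by positivity
    rw [h3]
    nlinarith [mul_le_mul_of_nonneg_left h1 h4.le, mul_pos hs0 h2]
  have du : ∀ t, 0 ≤ t → HasDerivAt (fun t => f t - m t)
      (2 * k * (f t + m t + s t - K) * f t * s t - δ * (f t - m t)) t := by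
    intro t ht
    refine (((h t).df t ⟨ht, le_rfl⟩).sub ((h t).dm t ⟨ht, le_rfl⟩)).congr_deriv ?_
    ring
  have hBpos : 0 < B := by rw [hB]; positivity
  -- u is large at time 2
  have u2 : 8 * μ / δ ≤ f 2 - m 2 := by
    have h1 : 0 ≤ (f 2 - m 2) - (-B + (8 * μ / δ + B) * (2 - 1)) := by
      refine TYC_fence (g := fun t => (f t - m t) - (-B + (8 * μ / δ + B) * (t - 1)))
        (g' := fun t => 2 * k * (f t + m t + s t - K) * f t * s t - δ * (f t - m t)
          - (8 * μ / δ + B)) one_le_two ?_ ?_ ?_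
      · intro t ht
        have h1 : HasDerivAt (fun t : ℝ => -B + (8 * μ / δ + B) * (t - 1)) (8 * μ / δ + B) t := by
          simpa using (((hasDerivAt_id t).sub_const 1).const_mul (8 * μ / δ + B)).const_add (-B)
        exact (du t (by linarith [ht.1])).sub h1
      · linarith [(mb 1 zero_le_one).1, fp 1 zero_le_one]
      · intro t ht h0
        have hp := (h t).excess ht.1 hk hδ hK hc0 hμ hμc hf0 hm0 hs0
        have hf := (h t).f_lower ht.1 ht.2 hk hδ hK hμ hμK hf0 hm0 hs0 hB hA hC hμA hμA1 hμC hμ3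
        rw [← hfl] at hf
        have hs := sκ t ht.1
        have h8 : 0 < 8 * μ / δ := by positivity
        have hu : f t - m t ≤ 8 * μ / δ := by nlinarith [ht.2]
        have hu' : δ * (f t - m t) ≤ 8 * μ := by
          have := mul_le_mul_of_nonneg_left hu hδ.le
          have e : δ * (8 * μ / δ) = 8 * μ := by field_simp
          linarith
        have h2 : c * fl * (κ * μ) ≤ (f t + m t + s t - K) * f t * s t :=
          mul_le_mul (mul_le_mul hp hf hfl0.le (by linarith)) hs (by positivity)
            (mul_nonneg (by linarith) (by linarith))
        have h3 : 2 * k * (c * fl * (κ * μ)) = (10 + 8 / δ) * μ := by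
          rw [hc]; field_simp
        have h4 := mul_le_mul_of_nonneg_left h2 (show 0 ≤ 2 * k by linarith)
        have h5 : (10 + 8 / δ) * μ = 10 * μ + 8 * μ / δ := by ring
        linarith
    linarith
  -- growth of u once it is large
  set η := k * κ * μ / 4 with hη
  have hη0 : 0 < η := by positivity
  have gr : ∀ t, 2 ≤ t → 8 * μ / δ ≤ f t - m t → η * (f t - m t) ^ 2 ≤
      2 * k * (f t + m t + s t - K) * f t * s t - δ * (f t - m t) := by
    intro t ht hu
    have hm := (mb t (by linarith)).2.1
    have hs := (sb t (by linarith)).2.1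
    have hs' := sκ t (by linarith)
    have h0 : 0 < μ / δ := by positivity
    have e : 8 * μ / δ = 8 * (μ / δ) := by ring
    rw [e] at hu
    have hKμ : K ≤ μ / δ := by rw [le_div_iff₀ hδ]; linarith
    set u := f t - m t with hudef
    have hu0 : 0 < u := by linarith
    have hf : u / 2 ≤ f t := by linarith
    have hp : u / 2 ≤ f t + m t + s t - K := by linarith
    have h1 : u / 2 * (u / 2) * (κ * μ) ≤ (f t + m t + s t - K) * f t * s t :=
      mul_le_mul (mul_le_mul hp hf (by positivity) (by linarith)) hs' (by positivity)
        (mul_nonneg (by linarith) (by linarith))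
    have h2 := mul_le_mul_of_nonneg_left h1 (show 0 ≤ 2 * k by linarith)
    have h3 : δ ≤ η * u := by
      have h4 : δ ^ 2 ≤ μ * (k * κ) := by
        rwa [div_le_iff₀ (by positivity)] at hμk
      have h5 : η * (8 * (μ / δ)) ≤ η * u := mul_le_mul_of_nonneg_left hu hη0.le
      have h6 : η * (8 * (μ / δ)) = 2 * (μ * (k * κ)) * μ / δ := by rw [hη]; field_simp; ring
      have h7 : δ ≤ 2 * (μ * (k * κ)) * μ / δ := by
        rw [le_div_iff₀ hδ]
        have : 0 < μ * (k * κ) := by positivity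
        nlinarith
      linarith
    have h8 := mul_le_mul_of_nonneg_right h3 hu0.le
    have h9 : 2 * k * (u / 2 * (u / 2) * (κ * μ)) = 2 * (η * u ^ 2) := by rw [hη]; ring
    nlinarith
  have h8 : 0 < 8 * μ / δ := by positivity
  have ub : ∀ t, 2 ≤ t → 8 * μ / δ ≤ f t - m t := by
    intro t ht
    have := TYC_fence (g := fun t => (f t - m t) - 8 * μ / δ) ht
      (fun r hr => (du r (by linarith [hr.1])).sub_const _) (by linarith) ?_
    · linarith
    · intro r hr h0
      have hu : 8 * μ / δ ≤ f r - m r := by linarith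
      have := gr r hr.1 hu
      have : 0 < η * (f r - m r) ^ 2 := by
        have : 0 < f r - m r := by linarith
        positivity
      linarith
  -- the reciprocal of u reaches zero
  set b := 2 + 2 / η * (f 2 - m 2)⁻¹ with hbdef
  have hu2 : 0 < f 2 - m 2 := by linarith
  have hb : 2 ≤ b := by
    have : 0 < 2 / η * (f 2 - m 2)⁻¹ := by positivity
    linarith
  have fin : 0 ≤ (f 2 - m 2)⁻¹ - η / 2 * (b - 2) - (f b - m b)⁻¹ := by
    refine TYC_fence (g := fun t => (f 2 - m 2)⁻¹ - η / 2 * (t - 2) - (f t - m t)⁻¹)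
      (g' := fun t => - (η / 2) - -(2 * k * (f t + m t + s t - K) * f t * s t - δ * (f t - m t))
        / (f t - m t) ^ 2) hb ?_ ?_ ?_
    · intro t ht
      have hu : 0 < f t - m t := by linarith [ub t ht.1]
      have h1 : HasDerivAt (fun t : ℝ => (f 2 - m 2)⁻¹ - η / 2 * (t - 2)) (-(η / 2)) t := by
        simpa using (((hasDerivAt_id t).sub_const 2).const_mul (η / 2)).const_sub (f 2 - m 2)⁻¹
      exact h1.sub ((du t (by linarith [ht.1])).inv hu.ne')
    · simp
    · intro t ht _
      have hu : 0 < f t - m t := by linarith [ub t ht.1]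
      have h1 := gr t ht.1 (ub t ht.1)
      have h2 : η ≤ (2 * k * (f t + m t + s t - K) * f t * s t - δ * (f t - m t))
        / (f t - m t) ^ 2 := by
        rwa [le_div_iff₀ (by positivity)]
      rw [neg_div]
      linarith
  have hub : 0 < f b - m b := by linarith [ub b hb]
  have h1 : η / 2 * (b - 2) = (f 2 - m 2)⁻¹ := by
    rw [hbdef]; field_simp; ring
  have := inv_pos.2 hub
  linarith

lemma TYC_fst {E F : Type*} [NormedAddCommGroup E] [NormedSpace ℝ E] [NormedAddCommGroup F]
    [NormedSpace ℝ F] {x : ℝ → E × F} {x' : E × F} {t : ℝ} (h : HasDerivAt x x' t) :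
    HasDerivAt (fun t => (x t).1) x'.1 t :=
  (ContinuousLinearMap.fst ℝ E F).hasFDerivAt.comp_hasDerivAt t h

lemma TYC_snd {E F : Type*} [NormedAddCommGroup E] [NormedSpace ℝ E] [NormedAddCommGroup F]
    [NormedSpace ℝ F] {x : ℝ → E × F} {x' : E × F} {t : ℝ} (h : HasDerivAt x x' t) :
    HasDerivAt (fun t => (x t).2) x'.2 t :=
  (ContinuousLinearMap.snd ℝ E F).hasFDerivAt.comp_hasDerivAt t h

/-- For the classical continuous-time TYC system, every strictly positive initial
datum admits a critical introduction rate `μ*` such that for every `μ > μ*` there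
is a solution blowing up in finite time (`limsup f = +∞` or `m → −∞` as
`t → T*⁻`); in particular, for `μ > μ*` no solution with this initial datum
exists on all of `[0, ∞)`. -/
theorem classical_TYC_blow_up_large_mu
    (β δ K : ℝ) (hβ : 0 < β) (hδ : 0 < δ) (hK : 0 < K) :
    ∀ f₀ m₀ s₀ : ℝ, 0 < f₀ → 0 < m₀ → 0 < s₀ →
    ∃ μstar : ℝ, 0 < μstar ∧
      ∀ μ : ℝ, μstar < μ →
        (∃ (T : ℝ), 0 < T ∧
          ∃ (f m s : ℝ → ℝ),
            f 0 = f₀ ∧ m 0 = m₀ ∧ s 0 = s₀ ∧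
            (∀ t ∈ Set.Ico (0 : ℝ) T,
              HasDerivAt f
                ((1 / 2) * β * (1 - (f t + m t + s t) / K) * f t * m t - δ * f t) t ∧
              HasDerivAt m
                ((1 / 2) * β * (1 - (f t + m t + s t) / K) * f t * m t
                  + β * (1 - (f t + m t + s t) / K) * f t * s t - δ * m t) t ∧
              HasDerivAt s (μ - δ * s t) t) ∧
            (Filter.limsup (fun t : ℝ => (f t : EReal))
                (nhdsWithin T (Set.Iio T)) = ⊤ ∨
             Filter.Tendsto m (nhdsWithin T (Set.Iio T)) Filter.atBot)) ∧
        ¬ ∃ (f m s : ℝ → ℝ),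
            f 0 = f₀ ∧ m 0 = m₀ ∧ s 0 = s₀ ∧
            ∀ t ∈ Set.Ici (0 : ℝ),
              HasDerivAt f
                ((1 / 2) * β * (1 - (f t + m t + s t) / K) * f t * m t - δ * f t) t ∧
              HasDerivAt m
                ((1 / 2) * β * (1 - (f t + m t + s t) / K) * f t * m t
                  + β * (1 - (f t + m t + s t) / K) * f t * s t - δ * m t) t ∧
              HasDerivAt s (μ - δ * s t) t := by
  intro f₀ m₀ s₀ hf₀ hm₀ hs₀
  set k := β / (2 * K) with hk
  have hk0 : 0 < k := by positivity
  obtain ⟨B, hB⟩ : ∃ B, B = K + f₀ + m₀ := ⟨_, rfl⟩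
  obtain ⟨A, hA⟩ : ∃ A, A = 2 * B ^ 2 / f₀ := ⟨_, rfl⟩
  obtain ⟨C, hC⟩ : ∃ C, C = k * (f₀ + B + s₀ + A) * f₀ * B + δ * f₀ + 1 := ⟨_, rfl⟩
  obtain ⟨κ, hκ⟩ : ∃ κ, κ = (1 - Real.exp (-δ)) / δ := ⟨_, rfl⟩
  obtain ⟨fl, hfl⟩ : ∃ fl, fl = f₀ / 4 * Real.exp (-4 * δ) := ⟨_, rfl⟩
  obtain ⟨c, hc⟩ : ∃ c, c = (10 + 8 / δ) / (2 * k * fl * κ) := ⟨_, rfl⟩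
  have hκ0 : 0 < κ := by
    rw [hκ]
    refine div_pos ?_ hδ
    rw [sub_pos, Real.exp_lt_one_iff]; linarith
  have hfl0 : 0 < fl := by rw [hfl]; positivity
  have hc0 : 0 < c := by rw [hc]; positivity
  have hB0 : 0 < B := by rw [hB]; positivity
  have hA0 : 0 < A := by rw [hA]; positivity
  have hC0 : 0 < C := by rw [hC]; positivity
  have p1 : 0 < δ * s₀ := by positivity
  have p2 : 0 < δ * (c + K) + k * c * (K + c) ^ 2 + (c + K) := by positivity
  have p3 : 0 < 2 * δ * (s₀ + A) := by positivity
  have p4 : 0 < 2 * C * A / f₀ := by positivity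
  have p5 : 0 < 2 * k * K ^ 3 := by positivity
  have p6 : 0 < δ ^ 2 / (k * κ) := by positivity
  have p7 : 0 < δ * K := by positivity
  refine ⟨δ * s₀ + (δ * (c + K) + k * c * (K + c) ^ 2 + (c + K)) + 2 * δ * (s₀ + A) + A +
    2 * C * A / f₀ + 2 * k * K ^ 3 + B + 1 + δ ^ 2 / (k * κ) + δ * K, by linarith, ?_⟩
  intro μ hμ
  -- translation to the auxiliary formulation
  have conv : ∀ (f m s : ℝ → ℝ) (b : ℝ), (∀ t ∈ Icc 0 b,
      HasDerivAt f
        ((1 / 2) * β * (1 - (f t + m t + s t) / K) * f t * m t - δ * f t) t ∧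
      HasDerivAt m
        ((1 / 2) * β * (1 - (f t + m t + s t) / K) * f t * m t
          + β * (1 - (f t + m t + s t) / K) * f t * s t - δ * m t) t ∧
      HasDerivAt s (μ - δ * s t) t) → TYCSol k δ K μ f m s b := by
    intro f m s b H
    refine ⟨fun t ht => (H t ht).1.congr_deriv ?_, fun t ht => (H t ht).2.1.congr_deriv ?_,
      fun t ht => (H t ht).2.2⟩
    · rw [hk]; field_simp; ring
    · rw [hk]; field_simp; ring
  have hno : ¬ ∃ (f m s : ℝ → ℝ),
      f 0 = f₀ ∧ m 0 = m₀ ∧ s 0 = s₀ ∧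
      ∀ t ∈ Set.Ici (0 : ℝ),
        HasDerivAt f
          ((1 / 2) * β * (1 - (f t + m t + s t) / K) * f t * m t - δ * f t) t ∧
        HasDerivAt m
          ((1 / 2) * β * (1 - (f t + m t + s t) / K) * f t * m t
            + β * (1 - (f t + m t + s t) / K) * f t * s t - δ * m t) t ∧
        HasDerivAt s (μ - δ * s t) t := by
    rintro ⟨f, m, s, rfl, rfl, rfl, H⟩
    exact TYC_no_global (fun b => conv f m s b fun t ht => H t ht.1) hk0 hδ hK (by linarith)
      hf₀ hm₀ hs₀ hB hA hC hκ hfl hc (by linarith) (by linarith) (by linarith) (by linarith)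
      (by linarith) (by linarith) (by linarith) (by linarith)
  refine ⟨?_, hno⟩
  let v : ℝ × ℝ × ℝ → ℝ × ℝ × ℝ := fun x =>
    ((1 / 2) * β * (1 - (x.1 + x.2.1 + x.2.2) / K) * x.1 * x.2.1 - δ * x.1,
      (1 / 2) * β * (1 - (x.1 + x.2.1 + x.2.2) / K) * x.1 * x.2.1
        + β * (1 - (x.1 + x.2.1 + x.2.2) / K) * x.1 * x.2.2 - δ * x.2.1,
      μ - δ * x.2.2)
  have hv : ContDiff ℝ 1 v := by
    simp only [v, div_eq_mul_inv]
    fun_prop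
  have comps : ∀ (x : ℝ → ℝ × ℝ × ℝ) (t : ℝ), HasDerivAt x (v (x t)) t →
      HasDerivAt (fun t => (x t).1) (v (x t)).1 t ∧
      HasDerivAt (fun t => (x t).2.1) (v (x t)).2.1 t ∧
      HasDerivAt (fun t => (x t).2.2) (v (x t)).2.2 t := by
    intro x t hx
    have h2 := TYC_snd hx
    exact ⟨TYC_fst hx, TYC_fst h2, TYC_snd h2⟩
  obtain ⟨T, hT, x, hx0, hx, hunb⟩ := TYC_maximal hv (f₀, m₀, s₀) (by
    rintro ⟨x, hx0, hx⟩
    exact hno ⟨fun t => (x t).1, fun t => (x t).2.1, fun t => (x t).2.2, by simp [hx0],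
      by simp [hx0], by simp [hx0], fun t ht => comps x t (hx t ht)⟩)
  have hx' := fun t ht => comps x t (hx t ht)
  refine ⟨T, hT, fun t => (x t).1, fun t => (x t).2.1, fun t => (x t).2.2, by simp [hx0],
      by simp [hx0], by simp [hx0], hx', Or.inl ?_⟩
  by_contra hlim
  obtain ⟨R, hR, -⟩ := EReal.lt_iff_exists_real_btwn.1 (lt_top_iff_ne_top.2 hlim)
  have hev : ∀ᶠ t in 𝓝[<] T, ((x t).1 : EReal) < R := eventually_lt_of_limsup_lt hR
  obtain ⟨l, hl, hlT⟩ := (mem_nhdsLT_iff_exists_Ioo_subset' hT).1 hev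
  have hl' : max 0 l < T := max_lt hT hl
  obtain ⟨R', hR'⟩ := (isCompact_Icc (a := (0:ℝ)) (b := max 0 l)).exists_bound_of_continuousOn
    (f := fun t => (x t).1)
    (fun t ht => (hx' t ⟨ht.1, ht.2.trans_lt hl'⟩).1.continuousAt.continuousWithinAt)
  have hμ0 : 0 < μ := by linarith
  refine hunb (max (max R R') (max (B + 2 * (μ / δ)) (μ / δ))) fun t ht => ?_
  have hsol : TYCSol k δ K μ (fun t => (x t).1) (fun t => (x t).2.1) (fun t => (x t).2.2) t :=
    conv _ _ _ t fun r hr => hx' r ⟨hr.1, hr.2.trans_lt ht.2⟩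
  have e1 : (x 0).1 = f₀ := by simp [hx0]
  have e2 : (x 0).2.1 = m₀ := by simp [hx0]
  have e3 : (x 0).2.2 = s₀ := by simp [hx0]
  have hfp := hsol.f_pos ht.1 (by simpa only [e1])
  have hsb := hsol.s_bounds ht.1 hδ (by simp only [e3]; linarith)
  have hmb := hsol.basic ht.1 hk0 hδ hK (by simp only [e3]; linarith) (by linarith)
    (by simpa only [e1]) (by simpa only [e2]) (by simpa only [e3])
  simp only [e1, e2, e3, ← hB] at hfp hsb hmb
  have hμδ : 0 < μ / δ := by positivity
  rw [Prod.norm_def, Prod.norm_def, Real.norm_eq_abs, Real.norm_eq_abs, Real.norm_eq_abs]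
  refine max_le (le_max_of_le_left ?_) (le_max_of_le_right (max_le_max ?_ ?_))
  · rcases le_or_gt t (max 0 l) with h | h
    · exact le_max_of_le_right (hR' t ⟨ht.1, h⟩)
    · refine le_max_of_le_left ?_
      have : ((x t).1 : EReal) < R := hlT ⟨(le_max_right _ _).trans_lt h, ht.2⟩
      rw [abs_of_pos hfp]
      exact (EReal.coe_lt_coe_iff.1 this).le
  · rw [abs_le]
    constructor <;> linarith [hmb.1, hmb.2.1, hsb.2.1]
  · rw [abs_le]
    constructor <;> linarith [hsb.1, hsb.2.1]
end
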